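/- Supersymmetric removal of the eigenvalue λ = 1: let λ ∈ ℂ with λ ≠ 1, and suppose there exists a function f : ℝ → ℂ, C^∞ on [0,1] and not identically zero on [0,1], satisfying for all ρ ∈ (0,1) the equation −(1−ρ²)f''(ρ) − (2/ρ)f'(ρ) + 2(λ+1)ρ f'(ρ) + (2(1−6ρ²+ρ⁴)/(ρ²(1+ρ²)²)) f(ρ) + λ(λ+1) f(ρ) = 0. Then there exists a function f̃ : ℝ → ℂ, C^∞ on [0,1] and not identically zero on [0,1], satisfying for all ρ ∈ (0,1) the supersymmetric equation −(1−ρ²)f̃''(ρ) − (2/ρ)f̃'(ρ) + 2(λ+1)ρ f̃'(ρ) + (2(3−ρ²)/(ρ²(1+ρ²))) f̃(ρ) + λ(λ+1) f̃(ρ) = 0. -/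

import Mathlib

open Set

/-- The spectral equation for the linearized wave maps operator. -/
def SpectralEq (l : ℂ) (f : ℝ → ℂ) (ρ : ℝ) : Prop :=
  -(1 - (ρ : ℂ)^2) * deriv (deriv f) ρ - (2 / (ρ : ℂ)) * deriv f ρ
    + 2 * (l + 1) * (ρ : ℂ) * deriv f ρ
    + (2 * (1 - 6 * (ρ : ℂ)^2 + (ρ : ℂ)^4) / ((ρ : ℂ)^2 * (1 + (ρ : ℂ)^2)^2)) * f ρ
    + l * (l + 1) * f ρ = 0

/-- The supersymmetric spectral equation, obtained from the spectral equation by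
removing the symmetry eigenvalue `λ = 1`. -/
def SuperSymSpectralEq (l : ℂ) (f : ℝ → ℂ) (ρ : ℝ) : Prop :=
  -(1 - (ρ : ℂ)^2) * deriv (deriv f) ρ - (2 / (ρ : ℂ)) * deriv f ρ
    + 2 * (l + 1) * (ρ : ℂ) * deriv f ρ
    + (2 * (3 - (ρ : ℂ)^2) / ((ρ : ℂ)^2 * (1 + (ρ : ℂ)^2))) * f ρ
    + l * (l + 1) * f ρ = 0

/-- Differentiation of a weighted average `∫₀¹ t ^ k F (t x) dt` on the unit interval. -/
theorem hasDerivWithinAt_integral_pow_smul_comp_mul {F : ℝ → ℂ}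
    (hF : ContDiffOn ℝ 1 F (Icc 0 1)) (k : ℕ) {x : ℝ} (hx : x ∈ Icc (0 : ℝ) 1) :
    HasDerivWithinAt (fun x => ∫ t in (0 : ℝ)..1, t ^ k • F (t * x))
      (∫ t in (0 : ℝ)..1, t ^ (k + 1) • derivWithin F (Icc 0 1) (t * x)) (Icc 0 1) x := by
  have hF' : ContinuousOn (derivWithin F (Icc 0 1)) (Icc 0 1) :=
    hF.continuousOn_derivWithin (uniqueDiffOn_Icc zero_lt_one) le_rfl
  set G : ℝ → ℂ := IccExtend zero_le_one ((Icc (0 : ℝ) 1).domRestrict (derivWithin F (Icc 0 1)))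
  have hG : Continuous G := hF'.domRestrict.Icc_extend'
  have hGeq : ∀ y ∈ Icc (0 : ℝ) 1, G y = derivWithin F (Icc 0 1) y := fun y hy =>
    IccExtend_of_mem _ _ hy
  obtain ⟨C, hC⟩ := isCompact_Icc.exists_bound_of_continuousOn hF'
  have hGC : ∀ y, ‖G y‖ ≤ C := fun y => hC _ (projIcc (0 : ℝ) 1 zero_le_one y).2
  let E : ℝ → ℂ := fun y => F 0 + ∫ s in (0 : ℝ)..y, G s
  have hE : ∀ y, HasDerivAt E (G y) y := fun y =>
    (hG.integral_hasStrictDerivAt 0 y).hasDerivAt.const_add _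
  have hEc : Continuous E := continuous_iff_continuousAt.2 fun y => (hE y).continuousAt
  have hEF : ∀ y ∈ Icc (0 : ℝ) 1, E y = F y := by
    intro y hy
    have hint : ∫ s in (0 : ℝ)..y, G s = F y - F 0 := by
      refine intervalIntegral.integral_eq_sub_of_hasDerivAt_of_le hy.1
        (hF.continuousOn.mono (Icc_subset_Icc_right hy.2)) (fun s hs => ?_)
        (hG.intervalIntegrable _ _)
      have hs' : s ∈ Ioo (0 : ℝ) 1 := ⟨hs.1, hs.2.trans_le hy.2⟩
      rw [hGeq s (Ioo_subset_Icc_self hs')]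
      exact (hF.differentiableOn one_ne_zero s
        (Ioo_subset_Icc_self hs')).hasDerivWithinAt.hasDerivAt (Icc_mem_nhds hs'.1 hs'.2)
    simp only [E, hint]
    ring
  have key := (intervalIntegral.hasDerivAt_integral_of_dominated_loc_of_deriv_le
    (μ := MeasureTheory.volume) (a := (0 : ℝ)) (b := 1) (bound := fun _ => C)
    (F := fun x t => t ^ k • E (t * x)) (F' := fun x t => t ^ (k + 1) • G (t * x))
    (x₀ := x) (s := univ) Filter.univ_mem
    (Filter.Eventually.of_forall fun y => by fun_prop)
    (Continuous.intervalIntegrable (by fun_prop) _ _) (by fun_prop)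
    (Filter.Eventually.of_forall fun t ht y _ => by
      rw [uIoc_of_le zero_le_one] at ht
      rw [norm_smul, norm_pow, Real.norm_eq_abs, abs_of_pos ht.1]
      exact (mul_le_of_le_one_left (norm_nonneg _) (pow_le_one₀ ht.1.le ht.2)).trans (hGC _))
    (by simp)
    (Filter.Eventually.of_forall fun t _ y _ => by
      have h := ((hE (t * y)).scomp y ((hasDerivAt_id y).const_mul t)).const_smul (t ^ k)
      refine h.congr_deriv ?_
      rw [smul_smul, mul_one, pow_succ])).2
  have hmem : ∀ y ∈ Icc (0 : ℝ) 1, ∀ t ∈ uIcc (0 : ℝ) 1, t * y ∈ Icc (0 : ℝ) 1 := by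
    intro y hy t ht
    rw [uIcc_of_le zero_le_one] at ht
    exact ⟨mul_nonneg ht.1 hy.1, mul_le_one₀ ht.2 hy.1 hy.2⟩
  have hval : ∀ y ∈ Icc (0 : ℝ) 1,
      ∫ t in (0 : ℝ)..1, t ^ k • F (t * y) = ∫ t in (0 : ℝ)..1, t ^ k • E (t * y) :=
    fun y hy => intervalIntegral.integral_congr fun t ht => by
      simp only [hEF _ (hmem y hy t ht)]
  refine (key.hasDerivWithinAt.congr hval (hval x hx)).congr_deriv ?_
  exact intervalIntegral.integral_congr fun t ht => by
    simp only [hGeq _ (hmem x hx t ht)]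

/-- Weighted averages `∫₀¹ t ^ k F (t x) dt` inherit finite smoothness on the unit interval. -/
theorem contDiffOn_integral_pow_smul_comp_mul (n : ℕ) : ∀ {F : ℝ → ℂ},
    ContDiffOn ℝ (n + 1) F (Icc 0 1) → ∀ k : ℕ,
    ContDiffOn ℝ n (fun x => ∫ t in (0 : ℝ)..1, t ^ k • F (t * x)) (Icc 0 1) := by
  have hu : UniqueDiffOn ℝ (Icc (0 : ℝ) 1) := uniqueDiffOn_Icc zero_lt_one
  induction n with
  | zero =>
    intro F hF k
    rw [Nat.cast_zero, contDiffOn_zero]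
    intro x hx
    exact (hasDerivWithinAt_integral_pow_smul_comp_mul (by simpa using hF) k hx).continuousWithinAt
  | succ n ih =>
    intro F hF k
    have hF1 : ContDiffOn ℝ 1 F (Icc 0 1) := hF.of_le (by norm_cast; omega)
    have hD := fun x hx => hasDerivWithinAt_integral_pow_smul_comp_mul hF1 k (x := x) hx
    rw [Nat.cast_succ, contDiffOn_succ_iff_derivWithin hu]
    refine ⟨fun x hx => (hD x hx).differentiableWithinAt, by simp, ?_⟩
    have hF' := ((contDiffOn_succ_iff_derivWithin hu).1 hF).2.2
    exact (ih (by simpa using hF') (k + 1)).congr fun x hx => (hD x hx).derivWithin (hu x hx)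

/-- **Hadamard's lemma** on the unit interval. -/
theorem exists_contDiffOn_eq_mul {f : ℝ → ℂ}
    (hf : ContDiffOn ℝ (⊤ : ℕ∞) f (Icc 0 1)) (h0 : f 0 = 0) :
    ∃ h : ℝ → ℂ, ContDiffOn ℝ (⊤ : ℕ∞) h (Icc 0 1) ∧
      ∀ x ∈ Icc (0 : ℝ) 1, f x = x * h x := by
  have hu : UniqueDiffOn ℝ (Icc (0 : ℝ) 1) := uniqueDiffOn_Icc zero_lt_one
  obtain ⟨hfd, hf'⟩ := (contDiffOn_infty_iff_derivWithin hu).1 hf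
  refine ⟨fun x => ∫ t in (0 : ℝ)..1, derivWithin f (Icc 0 1) (t * x), ?_, fun x hx => ?_⟩
  · rw [contDiffOn_infty]
    intro n
    simpa using contDiffOn_integral_pow_smul_comp_mul n
      (hf'.of_le (by exact_mod_cast le_top)) 0
  · have h1 := intervalIntegral.smul_integral_comp_mul_right
      (a := 0) (b := 1) (derivWithin f (Icc 0 1)) x
    have h2 : ∫ s in (0 : ℝ)..x, derivWithin f (Icc 0 1) s = f x - f 0 := by
      refine intervalIntegral.integral_eq_sub_of_hasDerivAt_of_le hx.1
        (hf.continuousOn.mono (Icc_subset_Icc_right hx.2)) (fun s hs => ?_)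
        ((hf'.continuousOn.mono ?_).intervalIntegrable)
      · have hs' : s ∈ Ioo (0 : ℝ) 1 := ⟨hs.1, hs.2.trans_le hx.2⟩
        exact (hfd s (Ioo_subset_Icc_self hs')).hasDerivWithinAt.hasDerivAt
          (Icc_mem_nhds hs'.1 hs'.2)
      · rw [uIcc_of_le hx.1]
        exact Icc_subset_Icc_right hx.2
    rw [zero_mul, one_mul, h2, h0, sub_zero, Complex.real_smul] at h1
    exact h1.symm

/-- The indicial condition: solutions of the spectral equation smooth up to the origin
vanish there. -/
theorem SpectralEq.apply_zero {l : ℂ} {f : ℝ → ℂ}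
    (hf : ContDiffOn ℝ (⊤ : ℕ∞) f (Icc 0 1))
    (heq : ∀ ρ ∈ Ioo (0 : ℝ) 1, SpectralEq l f ρ) : f 0 = 0 := by
  have hu : UniqueDiffOn ℝ (Icc (0 : ℝ) 1) := uniqueDiffOn_Icc zero_lt_one
  obtain ⟨-, hf'⟩ := (contDiffOn_infty_iff_derivWithin hu).1 hf
  obtain ⟨-, hf''⟩ := (contDiffOn_infty_iff_derivWithin hu).1 hf'
  have hfc := hf.continuousOn
  replace hf' := hf'.continuousOn
  replace hf'' := hf''.continuousOn
  set f₁ := derivWithin f (Icc 0 1)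
  set f₂ := derivWithin f₁ (Icc 0 1)
  have e₁ : ∀ x ∈ Ioo (0 : ℝ) 1, f₁ x = deriv f x := fun x hx =>
    derivWithin_of_mem_nhds (Icc_mem_nhds hx.1 hx.2)
  have e₂ : ∀ x ∈ Ioo (0 : ℝ) 1, f₂ x = deriv (deriv f) x := fun x hx => by
    rw [show f₂ x = deriv f₁ x from derivWithin_of_mem_nhds (Icc_mem_nhds hx.1 hx.2)]
    exact Filter.EventuallyEq.deriv_eq
      (Filter.eventually_of_mem (Ioo_mem_nhds hx.1 hx.2) e₁)
  let R : ℝ → ℂ := fun x =>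
    (1 + (x : ℂ) ^ 2) ^ 2 * (-(1 - (x : ℂ) ^ 2) * (x : ℂ) ^ 2 * f₂ x - 2 * (x : ℂ) * f₁ x
      + 2 * (l + 1) * (x : ℂ) ^ 3 * f₁ x + l * (l + 1) * (x : ℂ) ^ 2 * f x)
      + 2 * (1 - 6 * (x : ℂ) ^ 2 + (x : ℂ) ^ 4) * f x
  have hR : ContinuousOn R (Icc 0 1) := by fun_prop
  have hR0 : EqOn R (fun _ => 0) (Ioo 0 1) := by
    intro x hx
    have h := heq x hx
    have hx0 : (x : ℂ) ≠ 0 := by exact_mod_cast hx.1.ne'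
    have hx1 : (1 + (x : ℂ) ^ 2) ≠ 0 := by exact_mod_cast (by positivity : (1 + x ^ 2) ≠ 0)
    simp only [SpectralEq, ← e₁ x hx, ← e₂ x hx] at h
    simp only [R]
    field_simp at h
    linear_combination h
  have h0 := hR0.of_subset_closure hR continuousOn_const Ioo_subset_Icc_self
    (closure_Ioo zero_ne_one).ge (left_mem_Icc.2 zero_le_one)
  simpa [R] using h0

/-- The logarithmic coefficient in the first-order supersymmetric intertwining operator. -/
noncomputable def susyCoeff (l z : ℂ) : ℂ := -l * z - 1 / z + 4 * z / (1 + z ^ 2)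

theorem hasDerivAt_susyCoeff (l : ℂ) {z : ℂ} (h0 : z ≠ 0) (h1 : 1 + z ^ 2 ≠ 0) :
    HasDerivAt (susyCoeff l) (-l + 1 / z ^ 2 + 4 * (1 - z ^ 2) / (1 + z ^ 2) ^ 2) z := by
  have hid := hasDerivAt_id z
  have h := ((hid.const_mul (-l)).sub ((hasDerivAt_const z (1 : ℂ)).div hid h0)).add
    ((hid.const_mul 4).div ((hid.pow 2).const_add 1) h1)
  refine h.congr_deriv ?_
  simp only [id, Pi.pow_apply]
  field_simp
  ring

/-- The coefficient of `deriv f` in the derivative of the supersymmetric transform of a solution `f`. -/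
noncomputable def susyDerivCoeff (l z : ℂ) : ℂ := l * z - 3 / z + 4 * z / (1 + z ^ 2)

/-- The coefficient of `f` in the derivative of the supersymmetric transform of a solution `f`. -/
noncomputable def susyPotential (l z : ℂ) : ℂ :=
  l ^ 2 + 3 / z ^ 2 + (-12 - 4 * z ^ 2) / (1 + z ^ 2) ^ 2

theorem hasDerivAt_susyDerivCoeff (l : ℂ) {z : ℂ} (h0 : z ≠ 0) (h1 : 1 + z ^ 2 ≠ 0) :
    HasDerivAt (susyDerivCoeff l) (l + 3 / z ^ 2 + 4 * (1 - z ^ 2) / (1 + z ^ 2) ^ 2) z := by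
  have hid := hasDerivAt_id z
  have h := ((hid.const_mul l).sub ((hasDerivAt_const z (3 : ℂ)).div hid h0)).add
    ((hid.const_mul 4).div ((hid.pow 2).const_add 1) h1)
  refine h.congr_deriv ?_
  simp only [id, Pi.pow_apply]
  field_simp
  ring

theorem hasDerivAt_susyPotential (l : ℂ) {z : ℂ} (h0 : z ≠ 0) (h1 : 1 + z ^ 2 ≠ 0) :
    HasDerivAt (susyPotential l) (-6 / z ^ 3 + 8 * z * (5 + z ^ 2) / (1 + z ^ 2) ^ 3) z := by
  have hid := hasDerivAt_id z
  have h := (((hasDerivAt_const z (3 : ℂ)).div (hid.pow 2) (pow_ne_zero 2 h0)).const_add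
    (l ^ 2)).add ((((hid.pow 2).const_mul 4).const_sub (-12)).div
      (((hid.pow 2).const_add 1).pow 2) (pow_ne_zero 2 h1))
  refine h.congr_deriv ?_
  simp only [id, Pi.pow_apply]
  field_simp
  ring

/-- Supersymmetric removal of the eigenvalue `λ = 1`. -/
theorem supersymmetric_removal (l : ℂ) (hl : l ≠ 1) (f : ℝ → ℂ)
    (hf : ContDiffOn ℝ (⊤ : ℕ∞) f (Icc 0 1))
    (hf0 : ∃ ρ ∈ Icc (0 : ℝ) 1, f ρ ≠ 0)
    (heq : ∀ ρ ∈ Ioo (0 : ℝ) 1, SpectralEq l f ρ) :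
    ∃ g : ℝ → ℂ, ContDiffOn ℝ (⊤ : ℕ∞) g (Icc 0 1) ∧ (∃ ρ ∈ Icc (0 : ℝ) 1, g ρ ≠ 0) ∧
      ∀ ρ ∈ Ioo (0 : ℝ) 1, SuperSymSpectralEq l g ρ := by
  have hu : UniqueDiffOn ℝ (Icc (0 : ℝ) 1) := uniqueDiffOn_Icc zero_lt_one
  obtain ⟨h, hh, hfh⟩ := exists_contDiffOn_eq_mul hf (SpectralEq.apply_zero hf heq)
  have hf' := ((contDiffOn_infty_iff_derivWithin hu).1 hf).2
  have hz0 : ∀ x ∈ Ioo (0 : ℝ) 1, (x : ℂ) ≠ 0 := fun x hx => by exact_mod_cast hx.1.ne'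
  have hz1 : ∀ x : ℝ, 1 + (x : ℂ) ^ 2 ≠ 0 := fun x => by
    exact_mod_cast (by positivity : 1 + x ^ 2 ≠ 0)
  have hz2 : ∀ x ∈ Ioo (0 : ℝ) 1, 1 - (x : ℂ) ^ 2 ≠ 0 := fun x hx => by
    have : 1 - x ^ 2 ≠ 0 := by nlinarith [hx.1, hx.2]
    exact_mod_cast this
  let g : ℝ → ℂ := fun x => (1 - (x : ℂ) ^ 2) * derivWithin f (Icc 0 1) x - l * x * f x
    + (3 * (x : ℂ) ^ 2 - 1) * (1 + (x : ℂ) ^ 2)⁻¹ * h x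
  have hg : ∀ x ∈ Ioo (0 : ℝ) 1,
      g x = (1 - (x : ℂ) ^ 2) * deriv f x + susyCoeff l x * f x := by
    intro x hx
    have h0 := hz0 x hx
    have h1 := hz1 x
    simp only [g, derivWithin_of_mem_nhds (Icc_mem_nhds hx.1 hx.2),
      hfh x (Ioo_subset_Icc_self hx), susyCoeff]
    field_simp
    ring
  have hfo := hf.mono Ioo_subset_Icc_self
  have hf1 := ((contDiffOn_infty_iff_deriv_of_isOpen isOpen_Ioo).1 hfo)
  have hf2 := ((contDiffOn_infty_iff_deriv_of_isOpen isOpen_Ioo).1 hf1.2)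
  have d1 : ∀ x ∈ Ioo (0 : ℝ) 1, HasDerivAt f (deriv f x) x := fun x hx =>
    (hf1.1.differentiableAt (Ioo_mem_nhds hx.1 hx.2)).hasDerivAt
  have d2 : ∀ x ∈ Ioo (0 : ℝ) 1, HasDerivAt (deriv f) (deriv (deriv f) x) x := fun x hx =>
    (hf2.1.differentiableAt (Ioo_mem_nhds hx.1 hx.2)).hasDerivAt
  have dsq : ∀ x : ℝ, HasDerivAt (fun x : ℝ => 1 - (x : ℂ) ^ 2) (-(2 * (x : ℂ))) x := by
    intro x
    simpa using ((hasDerivAt_pow 2 (x : ℂ)).const_sub 1).comp_ofReal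
  have dg : ∀ x ∈ Ioo (0 : ℝ) 1, HasDerivAt g ((1 - (x : ℂ) ^ 2) * deriv (deriv f) x
      + (susyCoeff l x - 2 * x) * deriv f x
      + (-l + 1 / (x : ℂ) ^ 2 + 4 * (1 - (x : ℂ) ^ 2) / (1 + (x : ℂ) ^ 2) ^ 2) * f x) x := by
    intro x hx
    have hd := ((dsq x).mul (d2 x hx)).add
      ((hasDerivAt_susyCoeff l (hz0 x hx) (hz1 x)).comp_ofReal.mul (d1 x hx))
    refine (hd.congr_of_eventuallyEq
      (Filter.eventually_of_mem (Ioo_mem_nhds hx.1 hx.2) hg)).congr_deriv ?_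
    ring
  have dg' : ∀ x ∈ Ioo (0 : ℝ) 1, deriv g x = susyDerivCoeff l x * deriv f x
      + susyPotential l x * f x := by
    intro x hx
    have h := heq x hx
    have h0 := hz0 x hx
    have h1 := hz1 x
    rw [(dg x hx).deriv]
    rw [SpectralEq] at h
    simp only [susyCoeff, susyDerivCoeff, susyPotential]
    linear_combination (norm := skip) -h
    field_simp
    ring
  have ddg : ∀ x ∈ Ioo (0 : ℝ) 1, deriv (deriv g) x = susyDerivCoeff l x * deriv (deriv f) x
      + (3 / (x : ℂ) ^ 2 + l + 4 * (1 - (x : ℂ) ^ 2) / (1 + (x : ℂ) ^ 2) ^ 2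
        + susyPotential l x) * deriv f x
      + (-6 / (x : ℂ) ^ 3 + 8 * x * (5 + (x : ℂ) ^ 2) / (1 + (x : ℂ) ^ 2) ^ 3) * f x := by
    intro x hx
    have hd := ((hasDerivAt_susyDerivCoeff l (hz0 x hx) (hz1 x)).comp_ofReal.mul (d2 x hx)).add
      ((hasDerivAt_susyPotential l (hz0 x hx) (hz1 x)).comp_ofReal.mul (d1 x hx))
    rw [(hd.congr_of_eventuallyEq
      (Filter.eventually_of_mem (Ioo_mem_nhds hx.1 hx.2) dg')).deriv]
    ring
  refine ⟨g, ?_, ?_, ?_⟩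
  · have hof : ContDiff ℝ (⊤ : ℕ∞) (fun x : ℝ => (x : ℂ)) := Complex.ofRealCLM.contDiff
    have hinv : ContDiff ℝ (⊤ : ℕ∞) (fun x : ℝ => (1 + (x : ℂ) ^ 2)⁻¹) :=
      (contDiff_const.add (hof.pow 2)).inv hz1
    exact ((((contDiff_const.sub (hof.pow 2)).contDiffOn).mul hf').sub
      (((contDiff_const.mul hof).contDiffOn).mul hf)).add
      (((((contDiff_const.mul (hof.pow 2)).sub contDiff_const).mul hinv).contDiffOn).mul hh)
  · by_contra! hg0
    have hfz : EqOn f (fun _ => 0) (Ioo 0 1) := by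
      intro x hx
      have h := heq x hx
      have h0 := hz0 x hx
      have h1 := hz1 x
      have h2 := hz2 x hx
      have hgx := hg0 x (Ioo_subset_Icc_self hx)
      rw [hg x hx] at hgx
      have hgd : deriv g x = 0 := by
        have hev : g =ᶠ[nhds x] fun _ => 0 := Filter.eventually_of_mem
          (Ioo_mem_nhds hx.1 hx.2) fun y hy => hg0 y (Ioo_subset_Icc_self hy)
        rw [hev.deriv_eq]
        simp
      rw [dg' x hx] at hgd
      have hmul : (l - 1) ^ 2 * f x = 0 := by
        linear_combination (norm := skip) (1 - (x : ℂ) ^ 2) * hgd - susyDerivCoeff l x * hgx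
        simp only [susyCoeff, susyDerivCoeff, susyPotential]
        field_simp
        ring
      exact (mul_eq_zero.1 hmul).resolve_left (pow_ne_zero 2 (sub_ne_zero.2 hl))
    obtain ⟨x, hx, hne⟩ := hf0
    exact hne (hfz.of_subset_closure hf.continuousOn continuousOn_const Ioo_subset_Icc_self
      (closure_Ioo zero_ne_one).ge hx)
  · intro x hx
    have h := heq x hx
    have h0 := hz0 x hx
    have h1 := hz1 x
    rw [SuperSymSpectralEq, ddg x hx, dg' x hx, hg x hx]
    rw [SpectralEq] at h
    linear_combination (norm := skip) susyDerivCoeff l x * h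
    simp only [susyCoeff, susyDerivCoeff, susyPotential]
    field_simp
    ring
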